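/- Let $T>0$ and let $f:[0,T)\to(0,\infty)$ be differentiable with $f'(t)\le \frac{f(t)-2f(t)^2}{c(T-t)}$ for some $c>0$... Instead: Let $H:\mathbb{R}\times[0,T)\to\mathbb{R}$ be a smooth bounded solution of $\partial_t H=\frac{H''}{u''}+\frac{2H'}{u'}-\frac{2H^2-H}{u'}$, where $u'>0$, $u''>0$, and suppose $H(\cdot,0)\le M$ with $M\ge 1$, $H>0$, and $H(\rho,t)\to 0$ as $\rho\to\pm\infty$ for each $t$. Then $H(\rho,t)\le M$ for all $(\rho,t)\in\mathbb{R}\times[0,T)$. -/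

import Mathlib

open Real Set Filter

/-- Smooth functions have smooth partial derivative in the first variable. -/
lemma contDiff_partial (f : ℝ → ℝ → ℝ)
    (hf : ContDiff ℝ (⊤ : ℕ∞) (fun p : ℝ × ℝ => f p.1 p.2)) :
    ContDiff ℝ (⊤ : ℕ∞) (fun p : ℝ × ℝ => deriv (fun x => f x p.2) p.1) := by
  have h : (fun p : ℝ × ℝ => deriv (fun x => f x p.2) p.1)
      = fun p => fderiv ℝ (fun p : ℝ × ℝ => f p.1 p.2) p ((1 : ℝ), (0 : ℝ)) := by
    funext p
    have h1 : HasFDerivAt (fun p : ℝ × ℝ => f p.1 p.2)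
        (fderiv ℝ (fun p : ℝ × ℝ => f p.1 p.2) p) ((fun x : ℝ => (x, p.2)) p.1) :=
      (hf.differentiable (by simp) p).hasFDerivAt
    have h2 : HasDerivAt (fun x : ℝ => (x, p.2)) ((1 : ℝ), (0 : ℝ)) p.1 :=
      (hasDerivAt_id p.1).prodMk (hasDerivAt_const p.1 p.2)
    exact (h1.comp_hasDerivAt p.1 h2).deriv
  rw [h]
  exact (hf.fderiv_right (m := (⊤ : ℕ∞)) (by simp)).clm_apply contDiff_const

/-- Huber function. -/
noncomputable def huber (x : ℝ) : ℝ := if |x| ≤ 1 then x ^ 2 / 2 else |x| - 1 / 2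

lemma huber_ge (x : ℝ) : |x| - 1 / 2 ≤ huber x := by
  unfold huber
  split_ifs
  · nlinarith [sq_abs x, sq_nonneg (|x| - 1)]
  · exact le_rfl

lemma huber_nonneg (x : ℝ) : 0 ≤ huber x := by
  unfold huber
  split_ifs
  · positivity
  · linarith

lemma huber_le (x : ℝ) : huber x ≤ x ^ 2 / 2 := by
  unfold huber
  split_ifs
  · exact le_rfl
  · nlinarith [sq_abs x, sq_nonneg (|x| - 1)]

lemma huber_cont : Continuous huber := by
  unfold huber
  refine Continuous.if_le (by fun_prop) (by fun_prop) (by fun_prop) (by fun_prop) ?_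
  intro x hx
  rw [← sq_abs, hx]; norm_num

/-- Local touching from above. -/
lemma huber_touch (a : ℝ) : ∃ d c : ℝ, (d ≤ 1) ∧ (a ≤ 0 → d ≤ 0) ∧ (0 ≤ c) ∧ (c ≤ 1) ∧
    (¬ |a| ≤ 1 → c = 0) ∧
    ∀ᶠ x in nhds a, huber x ≤ huber a + d * (x - a) + c / 2 * (x - a) ^ 2 := by
  by_cases h : |a| ≤ 1
  · refine ⟨a, 1, (abs_le.1 h).2, id, zero_le_one, le_rfl, fun h' => absurd h h', ?_⟩
    refine Eventually.of_forall fun x => ?_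
    have : huber a = a ^ 2 / 2 := by simp [huber, h]
    have := huber_le x
    nlinarith
  · have h' : 1 < |a| := not_le.1 h
    have ev : ∀ᶠ x in nhds a, 1 < |x| := continuous_abs.continuousAt.eventually (lt_mem_nhds h')
    rcases lt_or_ge a 0 with ha | ha
    · refine ⟨-1, 0, by norm_num, fun _ => by norm_num, le_rfl, zero_le_one, fun _ => rfl, ?_⟩
      filter_upwards [ev, gt_mem_nhds ha] with x hx hx0
      rw [huber, huber, if_neg (not_le.2 hx), if_neg h, abs_of_neg ha, abs_of_neg hx0]
      linarith
    · have ha : 0 < a := by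
        rcases ha.eq_or_lt with h0 | h0
        · rw [← h0] at h'; norm_num at h'
        · exact h0
      refine ⟨1, 0, le_rfl, fun h0 => by linarith, le_rfl, zero_le_one, fun _ => rfl, ?_⟩
      filter_upwards [ev, lt_mem_nhds ha] with x hx hx0
      rw [huber, huber, if_neg (not_le.2 hx), if_neg h, abs_of_pos ha, abs_of_pos hx0]
      linarith

/-- Second derivative test at a local maximum. -/
lemma second_le (g : ℝ → ℝ) (hg : ContDiff ℝ 2 g) (a d c : ℝ)
    (hmax : ∀ᶠ x in nhds a, g x ≤ g a + d * (x - a) + c / 2 * (x - a) ^ 2) :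
    deriv g a = d ∧ iteratedDeriv 2 g a ≤ c := by
  set k : ℝ → ℝ := fun x => g x - (d * (x - a) + c / 2 * (x - a) ^ 2) with hk
  have hgd : Differentiable ℝ g := hg.differentiable (by norm_num)
  have hgd2 : Differentiable ℝ (deriv g) :=
    ((contDiff_succ_iff_deriv (n := 1)).1 (by simpa [one_add_one_eq_two] using hg)).2.2.differentiable
      (by norm_num)
  have hk1 : ∀ x, HasDerivAt k (deriv g x - (d + c * (x - a))) x := by
    intro x
    have h1 : HasDerivAt (fun x : ℝ => x - a) 1 x := (hasDerivAt_id x).sub_const a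
    have h2 := (hgd x).hasDerivAt.sub ((h1.const_mul d).add ((h1.pow 2).const_mul (c / 2)))
    refine h2.congr_deriv ?_
    simp; ring
  have hdk : deriv k = fun x => deriv g x - (d + c * (x - a)) := funext fun x => (hk1 x).deriv
  have hlm : IsLocalMax k a := by
    filter_upwards [hmax] with x hx
    simp only [hk]; simp; linarith
  have h0 : deriv k a = 0 := hlm.deriv_eq_zero
  have hdd : deriv (deriv k) a = deriv (deriv g) a - c := by
    rw [hdk]
    have h1 : HasDerivAt (fun x : ℝ => x - a) 1 a := (hasDerivAt_id a).sub_const a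
    have := (hgd2 a).hasDerivAt.sub ((h1.const_mul c).const_add d)
    refine (this.congr_deriv ?_).deriv
    ring
  constructor
  · rw [hdk] at h0; simp at h0; linarith
  · rw [iteratedDeriv_succ, iteratedDeriv_one]
    by_contra hcon
    have hlmin : IsLocalMin k a :=
      isLocalMin_of_deriv_deriv_pos (by rw [hdd]; linarith) h0 (hk1 a).continuousAt
    have hc : k =ᶠ[nhds a] fun _ => k a := by
      filter_upwards [hlm, hlmin] with x h1 h2 using le_antisymm h1 h2
    have : deriv (deriv k) a = 0 := by
      rw [(hc.deriv).deriv_eq]; simp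
    linarith

/-- First derivative at a maximum from the left. -/
lemma left_deriv_ge (g : ℝ → ℝ) (a k : ℝ) (ha : 0 < a) (hg : DifferentiableAt ℝ g a)
    (hmax : ∀ s ∈ Icc 0 a, g s - k * s ≤ g a - k * a) : k ≤ deriv g a := by
  have h := hg.hasDerivAt.hasDerivWithinAt (s := Iio a)
  rw [hasDerivWithinAt_iff_tendsto_slope' (by simp)] at h
  have : (nhdsWithin a (Iio a)).NeBot := inferInstance
  refine ge_of_tendsto h ?_
  filter_upwards [Ioo_mem_nhdsLT ha] with s hs
  have := hmax s ⟨hs.1.le, hs.2.le⟩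
  rw [slope_def_field, le_div_iff_of_neg (by linarith [hs.2])]
  linarith

lemma slice_fst (f : ℝ → ℝ → ℝ) (hf : ContDiff ℝ (⊤ : ℕ∞) (fun p : ℝ × ℝ => f p.1 p.2)) (s : ℝ) :
    ContDiff ℝ (⊤ : ℕ∞) (fun x => f x s) := by
  fun_prop

lemma slice_snd (f : ℝ → ℝ → ℝ) (hf : ContDiff ℝ (⊤ : ℕ∞) (fun p : ℝ × ℝ => f p.1 p.2)) (a : ℝ) :
    ContDiff ℝ (⊤ : ℕ∞) (fun x => f a x) := by
  fun_prop

lemma inv_bound (f : ℝ → ℝ → ℝ) (hf : Continuous (fun p : ℝ × ℝ => f p.1 p.2)) (t : ℝ)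
    (hpos : ∀ x, ∀ r ∈ Icc (0 : ℝ) t, 0 < f x r) :
    ∃ C : ℝ, 0 ≤ C ∧ ∀ x ∈ Icc (-1 : ℝ) 1, ∀ r ∈ Icc (0 : ℝ) t, (f x r)⁻¹ ≤ C := by
  have hcpt : IsCompact (Icc (-1 : ℝ) 1 ×ˢ Icc (0 : ℝ) t) := isCompact_Icc.prod isCompact_Icc
  obtain ⟨C, hC⟩ := hcpt.bddAbove_image (f := fun p : ℝ × ℝ => (f p.1 p.2)⁻¹)
    (hf.continuousOn.inv₀ fun p hp => (hpos p.1 p.2 hp.2).ne')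
  refine ⟨max C 0, le_max_right _ _, fun x hx r hr => le_trans ?_ (le_max_left _ _)⟩
  exact hC (mem_image_of_mem (fun p : ℝ × ℝ => (f p.1 p.2)⁻¹)
    (show (x, r) ∈ Icc (-1 : ℝ) 1 ×ˢ Icc (0 : ℝ) t from ⟨hx, hr⟩))

/-- Maximum principle for `H = u''/u'` along the Calabi-symmetric Kähler–Ricci flow:
a positive bounded solution of `∂ₜH = H''/u'' + 2H'/u' - (2H²-H)/u'` with `H(·,0) ≤ M`,
`M ≥ 1`, and spatial decay `H(ρ,t) → 0` as `ρ → ±∞` stays bounded by `M`. -/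
theorem max_principle_H (T : ℝ) (hT : 0 < T) (u H : ℝ → ℝ → ℝ)
    (husmooth : ContDiff ℝ (⊤ : ℕ∞) (fun p : ℝ × ℝ => u p.1 p.2))
    (hHsmooth : ContDiff ℝ (⊤ : ℕ∞) (fun p : ℝ × ℝ => H p.1 p.2))
    (hu1 : ∀ ρ : ℝ, ∀ t ∈ Ico (0 : ℝ) T, 0 < deriv (fun x => u x t) ρ)
    (hu2 : ∀ ρ : ℝ, ∀ t ∈ Ico (0 : ℝ) T, 0 < iteratedDeriv 2 (fun x => u x t) ρ)
    (hbdd : ∃ B : ℝ, ∀ ρ : ℝ, ∀ t ∈ Ico (0 : ℝ) T, |H ρ t| ≤ B)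
    (hpde : ∀ ρ : ℝ, ∀ t ∈ Ico (0 : ℝ) T,
      deriv (fun s => H ρ s) t =
        iteratedDeriv 2 (fun x => H x t) ρ / iteratedDeriv 2 (fun x => u x t) ρ
        + 2 * deriv (fun x => H x t) ρ / deriv (fun x => u x t) ρ
        - (2 * (H ρ t) ^ 2 - H ρ t) / deriv (fun x => u x t) ρ)
    (M : ℝ) (hM : 1 ≤ M)
    (hinit : ∀ ρ : ℝ, H ρ 0 ≤ M)
    (hpos : ∀ ρ : ℝ, ∀ t ∈ Ico (0 : ℝ) T, 0 < H ρ t)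
    (hdecay_bot : ∀ t ∈ Ico (0 : ℝ) T, Tendsto (fun ρ => H ρ t) atBot (nhds 0))
    (hdecay_top : ∀ t ∈ Ico (0 : ℝ) T, Tendsto (fun ρ => H ρ t) atTop (nhds 0)) :
    ∀ ρ : ℝ, ∀ t ∈ Ico (0 : ℝ) T, H ρ t ≤ M := by
  obtain ⟨B, hB⟩ := hbdd
  intro ρ t ht
  have hv := contDiff_partial u husmooth
  have hv2 := contDiff_partial (fun x t => deriv (fun x => u x t) x) hv
  have it2 : ∀ (x s : ℝ), iteratedDeriv 2 (fun x => u x s) x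
      = deriv (fun x => deriv (fun x => u x s) x) x := by
    intro x s; rw [iteratedDeriv_succ, iteratedDeriv_one]
  -- bounds on a compact set
  have hsub : ∀ s ∈ Icc (0 : ℝ) t, s ∈ Ico (0 : ℝ) T := fun s hs => ⟨hs.1, hs.2.trans_lt ht.2⟩
  obtain ⟨C, hC0, hC⟩ := inv_bound (fun x r => deriv (fun x => u x r) x) hv.continuous t
    (fun x r hr => hu1 x r (hsub r hr))
  obtain ⟨A, hA0, hA⟩ := inv_bound (fun x r => iteratedDeriv 2 (fun x => u x r) x)
    (by simp only [it2]; exact hv2.continuous) t (fun x r hr => hu2 x r (hsub r hr))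
  have hmono : ∀ s ∈ Icc (0 : ℝ) t, Monotone (fun x => deriv (fun x => u x s) x) := by
    intro s hs
    refine monotone_of_deriv_nonneg ?_ ?_
    · have : ContDiff ℝ (⊤ : ℕ∞) (fun x => deriv (fun x => u x s) x) :=
        slice_fst (fun x t => deriv (fun x => u x t) x) hv s
      exact this.differentiable (by simp)
    · intro x
      rw [← it2]
      exact (hu2 x s (hsub s hs)).le
  set K : ℝ := A + 2 * C with hK
  have hK0 : 0 ≤ K := by positivity
  have key : ∀ ε : ℝ, 0 < ε → H ρ t ≤ M + ε * (huber ρ + K * t) := by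
    intro ε hε
    by_contra hcon
    push Not at hcon
    set W : ℝ × ℝ → ℝ := fun p => H p.1 p.2 - ε * (huber p.1 + K * p.2) with hW
    have hWc : Continuous W :=
      hHsmooth.continuous.sub (continuous_const.mul
        ((huber_cont.comp continuous_fst).add (continuous_const.mul continuous_snd)))
    set R : ℝ := |ρ| + |B - M| / ε + 1 with hR
    have hR0 : |ρ| ≤ R := by
      have : 0 ≤ |B - M| / ε := by positivity
      linarith
    have hcpt2 : IsCompact (Icc (-R) R ×ˢ Icc (0 : ℝ) t) := isCompact_Icc.prod isCompact_Icc
    have hmem : (ρ, t) ∈ Icc (-R) R ×ˢ Icc (0 : ℝ) t := ⟨abs_le.1 hR0, ht.1, le_rfl⟩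
    obtain ⟨⟨a, s⟩, ⟨-, hs⟩, hmax⟩ := hcpt2.exists_isMaxOn ⟨_, hmem⟩ hWc.continuousOn
    have hs : s ∈ Icc (0 : ℝ) t := hs
    have hWM : M < W (a, s) := by
      refine lt_of_lt_of_le ?_ (hmax hmem)
      simp only [hW]; linarith
    have hmax' : ∀ x, ∀ r ∈ Icc (0 : ℝ) t, W (x, r) ≤ W (a, s) := by
      intro x r hr
      by_cases hx : |x| ≤ R
      · exact hmax (show (x, r) ∈ Icc (-R) R ×ˢ Icc (0 : ℝ) t from ⟨abs_le.1 hx, hr⟩)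
      · refine le_trans ?_ hWM.le
        have h1 : H x r ≤ B := (le_abs_self _).trans (hB x r (hsub r hr))
        have h2 : |B - M| / ε ≤ huber x := by
          have := huber_ge x
          have := abs_nonneg ρ
          linarith [not_le.1 hx]
        have h3 : |B - M| ≤ ε * huber x := by
          rw [div_le_iff₀ hε] at h2; linarith
        have h4 : 0 ≤ ε * (K * r) := mul_nonneg hε.le (mul_nonneg hK0 hr.1)
        have := le_abs_self (B - M)
        simp only [hW]
        rw [mul_add]; linarith
    have hHM : M < H a s := by
      have : 0 ≤ ε * (huber a + K * s) :=
        mul_nonneg hε.le (add_nonneg (huber_nonneg a) (mul_nonneg hK0 hs.1))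
      simp only [hW] at hWM; linarith
    have hs0 : 0 < s := by
      rcases hs.1.eq_or_lt with h | h
      · rw [← h] at hHM; linarith [hinit a]
      · exact h
    have hsT := hsub s hs
    -- time derivative
    have htime : ε * K ≤ deriv (fun r => H a r) s := by
      refine left_deriv_ge _ s _ hs0 ?_ ?_
      · have : ContDiff ℝ (⊤ : ℕ∞) (fun r => H a r) :=
          slice_snd H hHsmooth a
        exact this.differentiable (by simp) s
      · intro r hr
        have := hmax' a r ⟨hr.1, hr.2.trans hs.2⟩
        simp only [hW] at this
        linarith
    -- space derivatives
    obtain ⟨d, c, hd1, hd0, hc0, hc1, hc, htouch⟩ := huber_touch a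
    have hsp := second_le (fun x => H x s)
      (contDiff_infty.1 (slice_fst H hHsmooth s) 2) a (ε * d) (ε * c) (by
        filter_upwards [htouch] with x hx
        have h1 := hmax' x s hs
        simp only [hW] at h1
        have h2 := mul_le_mul_of_nonneg_left hx hε.le
        linarith)
    have hp := hpde a s hsT
    rw [hsp.1] at hp
    have v0 := hu1 a s hsT
    have w0 := hu2 a s hsT
    have t1 : iteratedDeriv 2 (fun x => H x s) a / iteratedDeriv 2 (fun x => u x s) a ≤ ε * A := by
      have e1 : iteratedDeriv 2 (fun x => H x s) a / iteratedDeriv 2 (fun x => u x s) a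
          ≤ (ε * c) / iteratedDeriv 2 (fun x => u x s) a :=
        div_le_div_of_nonneg_right hsp.2 w0.le
      refine e1.trans ?_
      by_cases ha : |a| ≤ 1
      · have := hA a (abs_le.1 ha) s hs
        rw [div_eq_mul_inv, mul_assoc]
        refine mul_le_mul_of_nonneg_left ?_ hε.le
        have i0 := inv_pos.2 w0
        nlinarith
      · rw [hc ha]; simp; positivity
    have t2 : 2 * (ε * d) / deriv (fun x => u x s) a ≤ ε * (2 * C) := by
      rcases le_total a 0 with ha | ha
      · have h1 : 2 * (ε * d) / deriv (fun x => u x s) a ≤ 0 :=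
          div_nonpos_of_nonpos_of_nonneg (by nlinarith [hd0 ha]) v0.le
        exact h1.trans (by positivity)
      · have h1 := hmono s hs ha
        have h2 := hC 0 (by constructor <;> norm_num) s hs
        have h3 : (deriv (fun x => u x s) a)⁻¹ ≤ C :=
          (inv_anti₀ (hu1 0 s hsT) h1).trans h2
        have i0 := inv_pos.2 v0
        have h4 : d * (deriv (fun x => u x s) a)⁻¹ ≤ C := by nlinarith
        rw [div_eq_mul_inv]
        nlinarith
    have t3 : 0 < (2 * (H a s) ^ 2 - H a s) / deriv (fun x => u x s) a :=
      div_pos (by nlinarith) v0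
    rw [hK, mul_add] at htime
    linarith
  have hcoef : 0 ≤ huber ρ + K * t := add_nonneg (huber_nonneg ρ) (mul_nonneg hK0 ht.1)
  refine le_of_forall_pos_le_add fun δ hδ => ?_
  refine (key (δ / (huber ρ + K * t + 1)) (by positivity)).trans ?_
  have : δ / (huber ρ + K * t + 1) * (huber ρ + K * t) ≤ δ := by
    rw [div_mul_eq_mul_div, div_le_iff₀ (by positivity)]
    nlinarith
  linarith
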